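/- arXiv:1805.04341 — 2 statements merged into one kernel-verified Lean document; each statement's English description precedes it below -/
import Mathlib

section
/- For all integers m ≥ 0 and p ≥ 0 with m + p ≥ 1, we have log F(m,p) ≤ (m+p)² · f(m/(m+p)). -/
/-- `F(m,p) = ∏_{1 ≤ i < j ≤ p} (2m + i + j − 1)/(i + j − 1)` (empty product is `1`). -/
noncomputable def F (m p : ℕ) : ℝ :=
  ∏ i ∈ Finset.Icc 1 p, ∏ j ∈ Finset.Ioc i p,
    (2 * (m : ℝ) + i + j - 1) / ((i : ℝ) + j - 1)

/-- The function `f(x) = x² log x − ½(1−x)² log(1−x) − ½(1+x)² log(1+x) + 2x log 2`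
(natural logarithms; `Real.log 0 = 0` gives the continuous extension `f 0 = f 1 = 0`). -/
noncomputable def f (x : ℝ) : ℝ :=
  x ^ 2 * Real.log x - (1 / 2) * (1 - x) ^ 2 * Real.log (1 - x)
    - (1 / 2) * (1 + x) ^ 2 * Real.log (1 + x) + 2 * x * Real.log 2

section

open Real Finset

private noncomputable def sqLog (x : ℝ) : ℝ := x ^ 2 * log x

/-- `(1+y)² log(1+y) + (1-y)² log(1-y)`; its second derivative is `6 + 2 log(1-y²)`. -/
private noncomputable def symSqLog (y : ℝ) : ℝ := sqLog (1 + y) + sqLog (1 - y)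

private noncomputable def symSqLogDeriv (y : ℝ) : ℝ :=
  2 * (1 + y) * log (1 + y) - 2 * (1 - y) * log (1 - y) + 2 * y

private lemma hasDerivAt_symSqLog {y : ℝ} (h0 : 0 ≤ y) (h1 : y < 1) :
    HasDerivAt symSqLog (symSqLogDeriv y) y := by
  have hp : (1 + y) ≠ 0 := by linarith
  have hm : (1 - y) ≠ 0 := by linarith
  have e1 : HasDerivAt (fun y : ℝ => 1 + y) 1 y := (hasDerivAt_id y).const_add 1
  have e2 : HasDerivAt (fun y : ℝ => 1 - y) (-1) y := (hasDerivAt_id y).const_sub 1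
  convert! ((e1.pow 2).mul (e1.log hp)).add ((e2.pow 2).mul (e2.log hm)) using 1
  simp only [symSqLogDeriv, Pi.pow_apply]
  field_simp
  ring

private lemma hasDerivAt_symSqLogDeriv {y : ℝ} (h0 : 0 ≤ y) (h1 : y < 1) :
    HasDerivAt symSqLogDeriv (6 + 2 * log (1 - y ^ 2)) y := by
  have hp : (1 + y) ≠ 0 := by linarith
  have hm : (1 - y) ≠ 0 := by linarith
  have e1 : HasDerivAt (fun y : ℝ => 1 + y) 1 y := (hasDerivAt_id y).const_add 1
  have e2 : HasDerivAt (fun y : ℝ => 1 - y) (-1) y := (hasDerivAt_id y).const_sub 1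
  convert! (((e1.const_mul 2).mul (e1.log hp)).sub
    ((e2.const_mul 2).mul (e2.log hm))).add ((hasDerivAt_id y).const_mul 2) using 1
  rw [show 1 - y ^ 2 = (1 + y) * (1 - y) by ring, log_mul hp hm]
  field_simp
  ring

/-- A function on `[0, b]` vanishing at `0` to first order and with nonnegative second derivative
is nonnegative. -/
private lemma nonneg_of_second_deriv_nonneg {g g' g'' : ℝ → ℝ} {b : ℝ} (hb : 0 ≤ b)
    (hg : ∀ y, 0 ≤ y → y ≤ b → HasDerivAt g (g' y) y)
    (hg' : ∀ y, 0 ≤ y → y ≤ b → HasDerivAt g' (g'' y) y)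
    (h0 : g 0 = 0) (h0' : g' 0 = 0) (h : ∀ y, 0 ≤ y → y ≤ b → 0 ≤ g'' y) : 0 ≤ g b := by
  have mono {u u' : ℝ → ℝ} (hu : ∀ y, 0 ≤ y → y ≤ b → HasDerivAt u (u' y) y)
      (hpos : ∀ y, 0 ≤ y → y ≤ b → 0 ≤ u' y) : MonotoneOn u (Set.Icc 0 b) := by
    refine monotoneOn_of_hasDerivWithinAt_nonneg (f' := u') (convex_Icc 0 b)
      (fun y hy => (hu y hy.1 hy.2).continuousAt.continuousWithinAt) ?_ ?_
    · intro y hy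
      have hy' := interior_subset hy
      exact (hu y hy'.1 hy'.2).hasDerivWithinAt
    · intro y hy
      have hy' := interior_subset hy
      exact hpos y hy'.1 hy'.2
  have m' := mono hg' h
  have m := mono hg fun y hy hyb => h0' ▸ m' ⟨le_rfl, hb⟩ ⟨hy, hyb⟩ hy
  exact h0 ▸ m ⟨le_rfl, hb⟩ ⟨hb, le_rfl⟩ hb

private lemma symSqLog_one : symSqLog 1 = 4 * log 2 := by
  norm_num [symSqLog, sqLog]

private lemma symSqLog_le {z : ℝ} (h0 : 0 ≤ z) (h1 : z ≤ 1) :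
    symSqLog z ≤ 3 * z ^ 2 - z ^ 4 / 6 := by
  rcases h1.eq_or_lt with rfl | h1
  · rw [symSqLog_one]
    linarith [log_two_lt_d9]
  have key := nonneg_of_second_deriv_nonneg (b := z)
    (g := fun y => (3 * y ^ 2 - y ^ 4 / 6) - symSqLog y)
    (g' := fun y => (6 * y - 2 / 3 * y ^ 3) - symSqLogDeriv y)
    (g'' := fun y => (6 - 2 * y ^ 2) - (6 + 2 * log (1 - y ^ 2))) h0 ?_ ?_ ?_ ?_ ?_
  · simpa using key
  · intro y hy hyz
    refine HasDerivAt.sub ?_ (hasDerivAt_symSqLog hy (by linarith))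
    convert! ((hasDerivAt_pow 2 y).const_mul 3).sub ((hasDerivAt_pow 4 y).div_const 6) using 1
    norm_num
    ring
  · intro y hy hyz
    refine HasDerivAt.sub ?_ (hasDerivAt_symSqLogDeriv hy (by linarith))
    convert! ((hasDerivAt_id y).const_mul 6).sub ((hasDerivAt_pow 3 y).const_mul (2 / 3)) using 1
    norm_num
    ring
  · simp [symSqLog, sqLog]
  · simp [symSqLogDeriv]
  · intro y hy hyz
    have := log_le_sub_one_of_pos (show 0 < 1 - y ^ 2 by nlinarith)
    linarith

private lemma neg_mul_sq_le_log {y : ℝ} (h0 : 0 ≤ y) (h1 : y ≤ 1 / 2) :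
    -(4 / 3 * y ^ 2) ≤ log (1 - y ^ 2) := by
  have hy : 0 < 1 - y ^ 2 := by nlinarith
  have := one_sub_inv_le_log_of_pos hy
  refine le_trans ?_ this
  rw [neg_le_sub_iff_le_add, inv_le_iff_one_le_mul₀ hy]
  nlinarith [mul_nonneg (sq_nonneg y) (show 0 ≤ 1 / 4 - y ^ 2 by nlinarith)]

private lemma le_symSqLog {z : ℝ} (h0 : 0 ≤ z) (h1 : z ≤ 1 / 2) :
    3 * z ^ 2 - 2 / 9 * z ^ 4 ≤ symSqLog z := by
  have key := nonneg_of_second_deriv_nonneg (b := z)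
    (g := fun y => symSqLog y - (3 * y ^ 2 - 2 / 9 * y ^ 4))
    (g' := fun y => symSqLogDeriv y - (6 * y - 8 / 9 * y ^ 3))
    (g'' := fun y => (6 + 2 * log (1 - y ^ 2)) - (6 - 8 / 3 * y ^ 2)) h0 ?_ ?_ ?_ ?_ ?_
  · simpa using key
  · intro y hy hyz
    refine HasDerivAt.sub (hasDerivAt_symSqLog hy (by linarith)) ?_
    convert! ((hasDerivAt_pow 2 y).const_mul 3).sub ((hasDerivAt_pow 4 y).const_mul (2 / 9)) using 1
    norm_num
    ring
  · intro y hy hyz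
    refine HasDerivAt.sub (hasDerivAt_symSqLogDeriv hy (by linarith)) ?_
    convert! ((hasDerivAt_id y).const_mul 6).sub ((hasDerivAt_pow 3 y).const_mul (8 / 9)) using 1
    norm_num
    ring
  · simp [symSqLog, sqLog]
  · simp [symSqLogDeriv]
  · intro y hy hyz
    linarith [neg_mul_sq_le_log hy (hyz.trans h1)]

private lemma sqLog_mul {x u : ℝ} (hx : x ≠ 0) :
    sqLog (x * u) = x ^ 2 * sqLog u + x ^ 2 * u ^ 2 * log x := by
  rcases eq_or_ne u 0 with rfl | hu
  · simp [sqLog]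
  · simp only [sqLog, log_mul hx hu]
    ring

private lemma sqLog_add_sqLog_eq {x d : ℝ} (hx : x ≠ 0) :
    sqLog (x + d) + sqLog (x - d) =
      x ^ 2 * symSqLog (d / x) + 2 * (x ^ 2 + d ^ 2) * log x := by
  have e1 : x + d = x * (1 + d / x) := by field_simp
  have e2 : x - d = x * (1 - d / x) := by field_simp
  rw [e1, e2, sqLog_mul hx, sqLog_mul hx, symSqLog]
  field_simp
  ring

private lemma log_add_log_le_sqLog (n : ℕ) :
    log (n + 1) + log (n + 1 / 2) ≤ sqLog (n + 2) - 2 * sqLog (n + 1) + sqLog n - 3 := by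
  rcases n.eq_zero_or_pos with rfl | hn
  · have : log (1 / 2) = -log 2 := by rw [one_div, log_inv]
    have h2 := log_two_gt_d9
    norm_num [sqLog] at this ⊢
    linarith
  have hn' : (1 : ℝ) ≤ n := by exact_mod_cast hn
  obtain ⟨x, hx⟩ : ∃ x : ℝ, x = n + 1 := ⟨_, rfl⟩
  have hx2 : 2 ≤ x := by linarith
  have hx0 : x ≠ 0 := by linarith
  have hy0 : 0 ≤ 1 / x := by positivity
  have hy1 : 1 / x ≤ 1 / 2 := one_div_le_one_div_of_le (by norm_num) hx2
  have key := mul_le_mul_of_nonneg_left (le_symSqLog hy0 hy1) (sq_nonneg x)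
  have e : x ^ 2 * (3 * (1 / x) ^ 2 - 2 / 9 * (1 / x) ^ 4) = 3 - 2 / 9 * (1 / x) ^ 2 := by
    field_simp
  have hs := sqLog_add_sqLog_eq (d := 1) hx0
  have hl : log (x - 1 / 2) ≤ log x - 1 / x / 2 := by
    have h1 := log_le_sub_one_of_pos (show 0 < 1 - 1 / x / 2 by linarith)
    rw [show x - 1 / 2 = x * (1 - 1 / x / 2) by field_simp,
      log_mul hx0 (by linarith)]
    linarith
  rw [show (n : ℝ) + 2 = x + 1 by linarith, show (n : ℝ) + 1 / 2 = x - 1 / 2 by linarith,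
    ← hx, show (n : ℝ) = x - 1 by linarith]
  have hk : sqLog x = x ^ 2 * log x := rfl
  nlinarith

private lemma sqLog_le_log_add_log {q : ℝ} (hq : 0 ≤ q) :
    sqLog (q + 3) - sqLog (q + 2) - sqLog (q + 1) + sqLog q ≤
      6 + 2 * log (q + 1) + 2 * log (q + 2) := by
  obtain ⟨x, hx⟩ : ∃ x : ℝ, x = q + 3 / 2 := ⟨_, rfl⟩
  have hx2 : 3 / 2 ≤ x := by linarith
  have hx0 : 0 < x := by linarith
  obtain ⟨y, hy⟩ : ∃ y : ℝ, y = 1 / 2 / x := ⟨_, rfl⟩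
  have hy0 : 0 ≤ y := by rw [hy]; positivity
  have hy1 : y ≤ 1 / 3 := by
    rw [hy, div_le_iff₀ hx0]
    linarith
  have hxy : x ^ 2 * y ^ 2 = 1 / 4 := by
    rw [hy]
    field_simp
    norm_num
  have h1 := sqLog_add_sqLog_eq (d := 1 / 2) hx0.ne'
  have h3 := sqLog_add_sqLog_eq (d := 3 / 2) hx0.ne'
  rw [← hy] at h1
  rw [show 3 / 2 / x = 3 * y by rw [hy]; ring] at h3
  have b1 := mul_le_mul_of_nonneg_left (le_symSqLog hy0 (by linarith)) (sq_nonneg x)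
  have b3 := mul_le_mul_of_nonneg_left
    (symSqLog_le (z := 3 * y) (by linarith) (by linarith)) (sq_nonneg x)
  have e1 : x ^ 2 * (3 * y ^ 2 - 2 / 9 * y ^ 4) = 3 / 4 - 1 / 18 * y ^ 2 := by
    linear_combination (3 - 2 / 9 * y ^ 2) * hxy
  have e3 : x ^ 2 * (3 * (3 * y) ^ 2 - (3 * y) ^ 4 / 6) = 27 / 4 - 27 / 8 * y ^ 2 := by
    linear_combination (27 - 27 / 2 * y ^ 2) * hxy
  have hl := neg_mul_sq_le_log hy0 (by linarith)
  have hll : log (x - 1 / 2) + log (x + 1 / 2) = 2 * log x + log (1 - y ^ 2) := by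
    rw [← log_mul (by linarith) (by linarith),
      show (x - 1 / 2) * (x + 1 / 2) = x ^ 2 * (1 - y ^ 2) by linear_combination hxy,
      log_mul (by positivity) (by nlinarith), log_pow]
    norm_num
  rw [show q + 3 = x + 3 / 2 by linarith, show q + 2 = x + 1 / 2 by linarith,
    show q + 1 = x - 1 / 2 by linarith, show q = x - 3 / 2 by linarith]
  nlinarith [sq_nonneg y]

/-- The value of `(m+p)² f(m/(m+p))`. -/
private noncomputable def G (m p : ℝ) : ℝ :=
  sqLog m + sqLog (m + p) - 1 / 2 * sqLog p - 1 / 2 * sqLog (2 * m + p)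
    + 2 * m * (m + p) * log 2

private lemma G_eq {m p : ℝ} (h : m + p ≠ 0) : (m + p) ^ 2 * f (m / (m + p)) = G m p := by
  obtain ⟨n, hn⟩ : ∃ n, n = m + p := ⟨_, rfl⟩
  rw [← hn] at h ⊢
  have e1 := sqLog_mul (u := m / n) h
  have e2 := sqLog_mul (u := 1 - m / n) h
  have e3 := sqLog_mul (u := 1 + m / n) h
  rw [show n * (m / n) = m by field_simp] at e1
  rw [show n * (1 - m / n) = p by field_simp; linarith] at e2
  rw [show n * (1 + m / n) = 2 * m + p by field_simp; linarith] at e3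
  rw [G, e1, e2, e3, ← hn]
  simp only [sqLog, f]
  field_simp
  ring

private lemma G_zero_left (p : ℝ) : G 0 p = 0 := by
  simp only [G, sqLog, mul_zero, zero_add]
  ring

private lemma G_zero_right (m : ℝ) : G m 0 = 0 := by
  rcases eq_or_ne m 0 with rfl | hm
  · exact G_zero_left 0
  · simp only [G, sqLog, add_zero, log_mul two_ne_zero hm]
    ring

private lemma log_le_G_mixed_diff (m p : ℕ) :
    log (2 * m + 2 * p + 1) + log (2 * m + 2 * p + 2)
        - log (2 * m + p + 1) - log (2 * m + p + 2) ≤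
      G (m + 1) (p + 1) - G (m + 1) p - G m (p + 1) + G m p := by
  have hA := log_add_log_le_sqLog (m + p)
  have hB := sqLog_le_log_add_log (q := 2 * m + p) (by positivity)
  push_cast at hA
  rw [show (2 * m + 2 * p + 1 : ℝ) = 2 * (m + p + 1 / 2) by ring,
    show (2 * m + 2 * p + 2 : ℝ) = 2 * (m + p + 1) by ring,
    log_mul two_ne_zero (by positivity), log_mul two_ne_zero (by positivity)]
  simp only [G]
  rw [show (m + 1 + (p + 1) : ℝ) = m + p + 2 by ring, show (m + 1 + p : ℝ) = m + p + 1 by ring,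
    show (m + (p + 1) : ℝ) = m + p + 1 by ring,
    show (2 * (m + 1) + (p + 1) : ℝ) = 2 * m + p + 3 by ring,
    show (2 * (m + 1) + p : ℝ) = 2 * m + p + 2 by ring,
    show (2 * m + (p + 1) : ℝ) = 2 * m + p + 1 by ring]
  linarith

private lemma F_succ (m p : ℕ) :
    F m (p + 1) = F m p * ∏ i ∈ range p, (2 * (m : ℝ) + p + i + 1) / ((p : ℝ) + i + 1) := by
  have h : ∏ i ∈ range p, (2 * (m : ℝ) + p + i + 1) / ((p : ℝ) + i + 1) =
      ∏ i ∈ Icc 1 p,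
        (2 * (m : ℝ) + i + ((p + 1 : ℕ) : ℝ) - 1) / ((i : ℝ) + ((p + 1 : ℕ) : ℝ) - 1) := by
    rw [range_eq_Ico, ← Ico_add_one_right_eq_Icc, prod_Ico_eq_prod_range, prod_Ico_eq_prod_range]
    refine prod_congr (by simp) fun i _ => ?_
    push_cast
    ring_nf
  rw [h, F, F, ← prod_mul_distrib, prod_Icc_succ_top (by omega), Ioc_self, prod_empty, mul_one]
  refine prod_congr rfl fun i hi => ?_
  rw [← prod_Ioc_succ_top (mem_Icc.mp hi).2]

private lemma F_pos (m p : ℕ) : 0 < F m p := by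
  induction p with
  | zero => simp [F]
  | succ p ih =>
    rw [F_succ]
    exact mul_pos ih (prod_pos fun i _ => by positivity)

private lemma log_F_succ (m p : ℕ) :
    log (F m (p + 1)) = log (F m p)
      + ∑ i ∈ range p, (log (2 * (m : ℝ) + p + i + 1) - log ((p : ℝ) + i + 1)) := by
  rw [F_succ, log_mul (F_pos m p).ne' (prod_pos fun i _ => by positivity).ne',
    log_prod fun i _ => by positivity]
  congr 1
  exact sum_congr rfl fun i _ => log_div (by positivity) (by positivity)

private lemma sum_log_sub_log (m p : ℕ) :
    ∑ i ∈ range p, (log (2 * ((m + 1 : ℕ) : ℝ) + p + i + 1) - log ((p : ℝ) + i + 1)) =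
      ∑ i ∈ range p, (log (2 * (m : ℝ) + p + i + 1) - log ((p : ℝ) + i + 1))
      + (log (2 * m + 2 * p + 1) + log (2 * m + 2 * p + 2)
        - log (2 * m + p + 1) - log (2 * m + p + 2)) := by
  have h := sum_range_sub
    (fun i : ℕ => log (2 * (m : ℝ) + p + i + 1) + log (2 * (m : ℝ) + p + i + 2)) p
  rw [← sub_eq_iff_eq_add', ← sum_sub_distrib]
  refine Eq.trans (sum_congr rfl fun i _ => ?_) (h.trans ?_)
  · push_cast
    ring_nf
  · push_cast
    ring_nf

private lemma sum_log_le_G_diff (m p : ℕ) :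
    ∑ i ∈ range p, (log (2 * (m : ℝ) + p + i + 1) - log ((p : ℝ) + i + 1)) ≤
      G m (p + 1) - G m p := by
  induction m with
  | zero => simp [G_zero_left]
  | succ m ih =>
    rw [sum_log_sub_log]
    have := log_le_G_mixed_diff m p
    push_cast
    linarith

private lemma log_F_le_G (m p : ℕ) : log (F m p) ≤ G m p := by
  induction p with
  | zero => simp [F, G_zero_right]
  | succ p ih =>
    rw [log_F_succ]
    have := sum_log_le_G_diff m p
    push_cast
    linarith

end

/-- For all integers `m ≥ 0`, `p ≥ 0` with `m + p ≥ 1`: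
`log F(m,p) ≤ (m+p)² f(m/(m+p))`. -/
theorem log_F_upper (m p : ℕ) (h : 1 ≤ m + p) :
    Real.log (F m p) ≤ ((m : ℝ) + p) ^ 2 * f ((m : ℝ) / (m + p)) := by
  rw [G_eq (by exact_mod_cast (by omega : m + p ≠ 0))]
  exact log_F_le_G m p
end

section
/- For all real numbers m ≥ 0 and p > 0, the double integral ∫_{y=0}^{p} ∫_{x=y}^{p} (log(2m+x+y) − log(x+y)) dx dy equals (m+p)² · f(m/(m+p)). -/
/-- `t ↦ t² log t / 2 - t² / 4` is a primitive of `t ↦ t log t` on the nonnegative reals. -/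
theorem integral_mul_log_of_nonneg {a b : ℝ} (ha : 0 ≤ a) (hab : a ≤ b) :
    ∫ t in a..b, t * Real.log t =
      (b ^ 2 * Real.log b / 2 - b ^ 2 / 4) - (a ^ 2 * Real.log a / 2 - a ^ 2 / 4) := by
  refine intervalIntegral.integral_eq_sub_of_hasDerivAt_of_le
    (f := fun t ↦ t ^ 2 * Real.log t / 2 - t ^ 2 / 4) hab ?_ (fun t ht ↦ ?_)
    (Real.continuous_mul_log.intervalIntegrable a b)
  · have h : Continuous fun t : ℝ ↦ t * (t * Real.log t) / 2 - t ^ 2 / 4 :=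
      ((continuous_id.mul Real.continuous_mul_log).div_const 2).sub (by fun_prop)
    refine h.continuousOn.congr fun t _ ↦ ?_
    ring
  · have ht0 : t ≠ 0 := (ha.trans_lt ht.1).ne'
    convert! (((hasDerivAt_pow 2 t).mul (Real.hasDerivAt_log ht0)).div_const 2).sub
      ((hasDerivAt_pow 2 t).div_const 4) using 1
    field_simp
    push_cast
    ring

/-- `∫ x in a..b, log (c + x)`, with no condition on the signs of the endpoints. -/
theorem integral_log_const_add (a b c : ℝ) :
    ∫ x in a..b, Real.log (c + x) =
      (c + b) * Real.log (c + b) - (c + a) * Real.log (c + a) - (b - a) := by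
  rw [intervalIntegral.integral_comp_add_left (fun x ↦ Real.log x) c, integral_log]
  ring

theorem intervalIntegrable_log_const_add (a b c : ℝ) :
    IntervalIntegrable (fun x ↦ Real.log (c + x)) MeasureTheory.volume a b := by
  have h : IntervalIntegrable Real.log MeasureTheory.volume (c + a) (c + b) :=
    intervalIntegral.intervalIntegrable_log'
  simpa using h.comp_add_left c

theorem sq_mul_log_mul {c x : ℝ} (hc : c ≠ 0) :
    x ^ 2 * Real.log (c * x) = x ^ 2 * (Real.log c + Real.log x) := by
  rcases eq_or_ne x 0 with rfl | hx
  · simp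
  · rw [Real.log_mul hc hx]

theorem sq_mul_log_div {c x : ℝ} (hc : c ≠ 0) :
    x ^ 2 * Real.log (x / c) = x ^ 2 * (Real.log x - Real.log c) := by
  rcases eq_or_ne x 0 with rfl | hx
  · simp
  · rw [Real.log_div hx hc]

theorem integral_log_sub_log (m p y : ℝ) :
    ∫ x in y..p, (Real.log (2 * m + x + y) - Real.log (x + y)) =
      (2 * m + p + y) * Real.log (2 * m + p + y)
        - (2 * m + 2 * y) * Real.log (2 * m + 2 * y)
        - (p + y) * Real.log (p + y) + 2 * y * Real.log (2 * y) := by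
  have h : ∀ x, Real.log (2 * m + x + y) - Real.log (x + y) =
      Real.log ((2 * m + y) + x) - Real.log (y + x) := fun x ↦ by
    rw [add_right_comm, add_comm x y]
  simp_rw [h]
  rw [intervalIntegral.integral_sub (intervalIntegrable_log_const_add _ _ _)
    (intervalIntegrable_log_const_add _ _ _), integral_log_const_add, integral_log_const_add,
    show 2 * m + y + p = 2 * m + p + y by ring, show 2 * m + y + y = 2 * m + 2 * y by ring,
    add_comm y p, ← two_mul y]
  ring

theorem sq_mul_f_div {m p : ℝ} (hm : 0 ≤ m) (hp : 0 < p) :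
    (m + p) ^ 2 * f (m / (m + p)) =
      m ^ 2 * Real.log m - p ^ 2 * Real.log p / 2
        - (2 * m + p) ^ 2 * Real.log (2 * m + p) / 2 + (m + p) ^ 2 * Real.log (m + p)
        + 2 * m * (m + p) * Real.log 2 := by
  have hs : m + p ≠ 0 := by positivity
  have h1 : 1 - m / (m + p) = p / (m + p) := by field_simp; ring
  have h2 : 1 + m / (m + p) = (2 * m + p) / (m + p) := by field_simp; ring
  have h : (m + p) ^ 2 * f (m / (m + p)) =
      m ^ 2 * Real.log (m / (m + p)) - p ^ 2 * Real.log (p / (m + p)) / 2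
        - (2 * m + p) ^ 2 * Real.log ((2 * m + p) / (m + p)) / 2
        + 2 * m * (m + p) * Real.log 2 := by
    rw [f, h1, h2]
    field_simp
  rw [h, sq_mul_log_div hs, sq_mul_log_div hs, sq_mul_log_div hs]
  ring

/-- For real `m ≥ 0` and `p > 0`:
`∫_{y=0}^{p} ∫_{x=y}^{p} (log(2m+x+y) − log(x+y)) dx dy = (m+p)² f(m/(m+p))`. -/
theorem double_integral_eq (m p : ℝ) (hm : 0 ≤ m) (hp : 0 < p) :
    (∫ y in (0 : ℝ)..p, ∫ x in y..p, (Real.log (2 * m + x + y) - Real.log (x + y)))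
      = (m + p) ^ 2 * f (m / (m + p)) := by
  have hL := Real.continuous_mul_log
  have i1 : IntervalIntegrable (fun y ↦ (2 * m + p + y) * Real.log (2 * m + p + y))
      MeasureTheory.volume 0 p :=
    (hL.comp (continuous_const.add continuous_id)).intervalIntegrable _ _
  have i2 : IntervalIntegrable (fun y ↦ (2 * m + 2 * y) * Real.log (2 * m + 2 * y))
      MeasureTheory.volume 0 p :=
    (hL.comp (continuous_const.add (continuous_const.mul continuous_id))).intervalIntegrable _ _
  have i3 : IntervalIntegrable (fun y ↦ (p + y) * Real.log (p + y)) MeasureTheory.volume 0 p :=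
    (hL.comp (continuous_const.add continuous_id)).intervalIntegrable _ _
  have i4 : IntervalIntegrable (fun y ↦ 2 * y * Real.log (2 * y)) MeasureTheory.volume 0 p :=
    (hL.comp (continuous_const.mul continuous_id)).intervalIntegrable _ _
  simp_rw [integral_log_sub_log]
  rw [intervalIntegral.integral_add ((i1.sub i2).sub i3) i4,
    intervalIntegral.integral_sub (i1.sub i2) i3, intervalIntegral.integral_sub i1 i2,
    intervalIntegral.integral_comp_add_left (fun t ↦ t * Real.log t) (2 * m + p),
    intervalIntegral.integral_comp_add_mul (fun t ↦ t * Real.log t) two_ne_zero (2 * m),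
    intervalIntegral.integral_comp_add_left (fun t ↦ t * Real.log t) p,
    intervalIntegral.integral_comp_mul_left (fun t ↦ t * Real.log t) two_ne_zero,
    integral_mul_log_of_nonneg (by linarith) (by linarith),
    integral_mul_log_of_nonneg (by linarith) (by linarith),
    integral_mul_log_of_nonneg (by linarith) (by linarith),
    integral_mul_log_of_nonneg (by linarith) (by linarith), sq_mul_f_div hm hp,
    show 2 * m + p + p = 2 * (m + p) by ring, show 2 * m + 2 * p = 2 * (m + p) by ring,
    ← two_mul p]
  simp only [mul_zero, add_zero, smul_eq_mul]
  have e1 := sq_mul_log_mul (x := m) (two_ne_zero (α := ℝ))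
  have e2 := sq_mul_log_mul (x := p) (two_ne_zero (α := ℝ))
  have e3 := sq_mul_log_mul (x := m + p) (two_ne_zero (α := ℝ))
  linear_combination e1 - e2 + e3
end
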